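/- Let Λ = ℤ⁸ with standard basis (e, f, e₁, f₁, e₂, f₂, v₁, v₂) and the symmetric bilinear form B determined by B(e,f) = B(e₁,f₁) = B(e₂,f₂) = 1, B(v₁,v₁) = B(v₂,v₂) = −2, all other pairings of distinct basis vectors equal to 0, and B(e,e) = B(f,f) = B(e₁,e₁) = B(f₁,f₁) = B(e₂,e₂) = B(f₂,f₂) = 0, extended ℚ-bilinearly to ℚ⁸. Let d ≥ 1 and h = e + d·f. Let g : ℚ⁸ → ℚ⁸ be a ℚ-linear map such that g(ℤ⁸) = ℤ⁸, B(g(x), g(y)) = B(x,y) for all x, y ∈ ℚ⁸, g(h) = h, and g(x) − x ∈ ℤ⁸ for every x ∈ ℚ⁸ with B(x,w) ∈ ℤ for all w ∈ ℤ⁸. Then for every x ∈ ℚ⁸ with B(x,h) = 0 and B(x,z) ∈ ℤ for all z ∈ ℤ⁸ with B(z,h) = 0, one has g(x) − x ∈ ℤ⁸ and B(g(x) − x, h) = 0. -/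

import Mathlib

/-- The bilinear form of the OG6 lattice `U ⊕ U ⊕ U ⊕ A₁(−1)^{⊕2}`, extended
`ℚ`-bilinearly to `ℚ⁸`, with basis `(e, f, e₁, f₁, e₂, f₂, v₁, v₂)`. -/
def BOG6Q (x y : Fin 8 → ℚ) : ℚ :=
  x 0 * y 1 + x 1 * y 0 + x 2 * y 3 + x 3 * y 2 + x 4 * y 5 + x 5 * y 4
    - 2 * x 6 * y 6 - 2 * x 7 * y 7

/-- Coercion `ℤ⁸ → ℚ⁸`. -/
def icast8 (z : Fin 8 → ℤ) : Fin 8 → ℚ := fun i => (z i : ℚ)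

/-- The integral points of `ℚ⁸`. -/
def intPts : Set (Fin 8 → ℚ) := {x | ∀ i, ∃ n : ℤ, x i = n}

/-- An isometry of the OG6 lattice fixing `h = e + d·f` and acting trivially on the
discriminant group restricts to an element of the stable orthogonal group of the
orthogonal complement of `h`: for every `x` in the dual of `Λ_h`, one has
`g(x) − x ∈ Λ_h`. -/
theorem stmt12 (d : ℤ) (hd : 1 ≤ d)
    (g : (Fin 8 → ℚ) →ₗ[ℚ] (Fin 8 → ℚ))
    (hgL : ⇑g '' intPts = intPts)
    (hgB : ∀ x y, BOG6Q (g x) (g y) = BOG6Q x y)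
    (hgh : g (icast8 ![1, d, 0, 0, 0, 0, 0, 0]) = icast8 ![1, d, 0, 0, 0, 0, 0, 0])
    (hdisc : ∀ x : Fin 8 → ℚ,
      (∀ w : Fin 8 → ℤ, ∃ n : ℤ, BOG6Q x (icast8 w) = n) → g x - x ∈ intPts) :
    ∀ x : Fin 8 → ℚ,
      BOG6Q x (icast8 ![1, d, 0, 0, 0, 0, 0, 0]) = 0 →
      (∀ z : Fin 8 → ℤ, BOG6Q (icast8 z) (icast8 ![1, d, 0, 0, 0, 0, 0, 0]) = 0 →
        ∃ n : ℤ, BOG6Q x (icast8 z) = n) →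
      g x - x ∈ intPts ∧
        BOG6Q (g x - x) (icast8 ![1, d, 0, 0, 0, 0, 0, 0]) = 0 := by
  intro x hx hz
  set h := icast8 ![1, d, 0, 0, 0, 0, 0, 0] with hh
  constructor
  · have key := hdisc (x - x 0 • h) (by
      intro w
      obtain ⟨n, hn⟩ := hz ![w 0, -d * w 0, w 2, w 3, w 4, w 5, w 6, w 7] (by
        simp [BOG6Q, icast8, hh]
        ring)
      refine ⟨n, ?_⟩
      rw [← hn]
      simp [BOG6Q, icast8, hh]
      ring)
    have e : g (x - x 0 • h) - (x - x 0 • h) = g x - x := by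
      rw [map_sub, map_smul, hgh]
      abel
    rwa [e] at key
  · have e : BOG6Q (g x - x) h = BOG6Q (g x) h - BOG6Q x h := by
      simp only [BOG6Q, Pi.sub_apply]
      ring
    have e2 := hgB x h
    rw [hgh] at e2
    rw [e, e2, sub_self]
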